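/- arXiv:math/0702510 — 2 statements merged into one kernel-verified Lean document; each statement's English description precedes it below -/
import Mathlib

section
/- Let p and q be distinct prime numbers and N = p·q. Then the defect of the Fourier matrix satisfies d(F_{pq}) = 2(p−1)(q−1). -/
open Matrix ComplexConjugate

noncomputable section

/-- The real vector space `S(U)` of real `N×N` matrices `R` such that for all `i < j`,
`∑ k, U i k * conj (U j k) * (R i k - R j k) = 0`. -/
def defectSpace {N : ℕ} (U : Matrix (Fin N) (Fin N) ℂ) :
    Submodule ℝ (Matrix (Fin N) (Fin N) ℝ) where
  carrier := {R | ∀ i j : Fin N, i < j →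
    ∑ k, U i k * conj (U j k) * ((R i k : ℂ) - (R j k : ℂ)) = 0}
  zero_mem' := by
    intro i j hij
    simp
  add_mem' := by
    intro R R' hR hR' i j hij
    have h1 := hR i j hij
    have h2 := hR' i j hij
    have key : ∀ k, U i k * conj (U j k) * (((R + R') i k : ℂ) - ((R + R') j k : ℂ))
        = U i k * conj (U j k) * ((R i k : ℂ) - (R j k : ℂ))
          + U i k * conj (U j k) * ((R' i k : ℂ) - (R' j k : ℂ)) := by
      intro k
      simp only [Matrix.add_apply]
      push_cast
      ring
    rw [Finset.sum_congr rfl fun k _ => key k, Finset.sum_add_distrib, h1, h2, add_zero]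
  smul_mem' := by
    intro c R hR i j hij
    have h1 := hR i j hij
    have key : ∀ k, U i k * conj (U j k) * (((c • R) i k : ℂ) - ((c • R) j k : ℂ))
        = (c : ℂ) * (U i k * conj (U j k) * ((R i k : ℂ) - (R j k : ℂ))) := by
      intro k
      simp only [Matrix.smul_apply, smul_eq_mul]
      push_cast
      ring
    rw [Finset.sum_congr rfl fun k _ => key k, ← Finset.mul_sum, h1, mul_zero]

/-- The defect of a unitary matrix `U`: `d(U) = dim_ℝ S(U) - (2N - 1)`. -/
def defect {N : ℕ} (U : Matrix (Fin N) (Fin N) ℂ) : ℕ :=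
  Module.finrank ℝ (defectSpace U) - (2 * N - 1)

/-- The Fourier matrix `F_N`, with entries `exp(2πi(i-1)(j-1)/N)/√N` (0-based indexing). -/
def fourierMatrix (N : ℕ) : Matrix (Fin N) (Fin N) ℂ :=
  Matrix.of fun i j : Fin N =>
    Complex.exp (2 * Real.pi * Complex.I * (i : ℕ) * (j : ℕ) / N) / (Real.sqrt N : ℝ)

/-- The identification of `Fin N` with `ZMod N` by casting. -/
def finEquivZMod (N : ℕ) [NeZero N] : Fin N ≃ ZMod N where
  toFun i := ((i : ℕ) : ZMod N)
  invFun z := ⟨z.val, z.val_lt⟩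
  left_inv i := Fin.ext (ZMod.val_cast_of_lt i.isLt)
  right_inv z := ZMod.natCast_zmod_val z

theorem fourierMatrix_apply_eq_stdAddChar {N : ℕ} [NeZero N] (i j : Fin N) :
    fourierMatrix N i j =
      ZMod.stdAddChar (finEquivZMod N i * finEquivZMod N j) / (Real.sqrt N : ℝ) := by
  have h : finEquivZMod N i * finEquivZMod N j = (((i : ℕ) * (j : ℕ) : ℤ) : ZMod N) := by
    simp [finEquivZMod]
  rw [h, ZMod.stdAddChar_coe]
  simp only [fourierMatrix, Matrix.of_apply]
  push_cast
  ring_nf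

/-- The discrete Fourier transform of real functions, as a real-linear map. -/
def realDFT (N : ℕ) [NeZero N] : (ZMod N → ℝ) →ₗ[ℝ] (ZMod N → ℂ) :=
  (ZMod.dft (N := N) (E := ℂ)).toLinearMap.restrictScalars ℝ ∘ₗ
    Complex.ofRealCLM.toLinearMap.compLeft (ZMod N)

theorem realDFT_apply {N : ℕ} [NeZero N] (x : ZMod N → ℝ) (m : ZMod N) :
    realDFT N x m = ∑ k, ZMod.stdAddChar (-(k * m)) * (x k : ℂ) := by
  simp [realDFT, ZMod.dft_apply]

theorem realDFT_injective (N : ℕ) [NeZero N] : Function.Injective (realDFT N) := by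
  intro x y h
  have h' := ZMod.dft.injective h
  funext k
  exact Complex.ofReal_injective (congrFun h' k)

theorem realDFT_neg {N : ℕ} [NeZero N] (x : ZMod N → ℝ) (m : ZMod N) :
    realDFT N x (-m) = conj (realDFT N x m) := by
  simp [realDFT_apply, map_sum, ← AddChar.map_neg_eq_conj]

/-- The discrete Hartley transform: the sum of the real and imaginary parts of the discrete
Fourier transform. -/
def hartley (N : ℕ) [NeZero N] : (ZMod N → ℝ) →ₗ[ℝ] (ZMod N → ℝ) :=
  (Complex.reLm + Complex.imLm).compLeft (ZMod N) ∘ₗ realDFT N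

theorem hartley_apply {N : ℕ} [NeZero N] (x : ZMod N → ℝ) (m : ZMod N) :
    hartley N x m = (realDFT N x m).re + (realDFT N x m).im := rfl

theorem realDFT_eq_zero_iff {N : ℕ} [NeZero N] (x : ZMod N → ℝ) (m : ZMod N) :
    realDFT N x m = 0 ↔ hartley N x m = 0 ∧ hartley N x (-m) = 0 := by
  rw [hartley_apply, hartley_apply, realDFT_neg, Complex.conj_re, Complex.conj_im,
    Complex.ext_iff, Complex.zero_re, Complex.zero_im]
  constructor
  · rintro ⟨h₁, h₂⟩
    simp [h₁, h₂]
  · rintro ⟨h₁, h₂⟩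
    constructor <;> linarith

theorem hartley_injective (N : ℕ) [NeZero N] : Function.Injective (hartley N) := by
  rw [injective_iff_map_eq_zero]
  intro x hx
  apply (injective_iff_map_eq_zero (realDFT N)).mp (realDFT_injective N)
  funext m
  exact (realDFT_eq_zero_iff x m).mpr ⟨congrFun hx m, congrFun hx (-m)⟩

/-- The rows of a real matrix, as functions on `ZMod N` indexed by `ZMod N`. -/
def rowsZMod (N : ℕ) [NeZero N] :
    Matrix (Fin N) (Fin N) ℝ →ₗ[ℝ] (ZMod N → ZMod N → ℝ) where
  toFun R i k := R ((finEquivZMod N).symm i) ((finEquivZMod N).symm k)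
  map_add' _ _ := rfl
  map_smul' _ _ := rfl

theorem rowsZMod_apply {N : ℕ} [NeZero N] (R : Matrix (Fin N) (Fin N) ℝ) (i k : ZMod N) :
    rowsZMod N R i k = R ((finEquivZMod N).symm i) ((finEquivZMod N).symm k) := rfl

theorem sum_fourierMatrix_eq {N : ℕ} [NeZero N] (R : Matrix (Fin N) (Fin N) ℝ) (i j : ZMod N) :
    ∑ k, fourierMatrix N ((finEquivZMod N).symm i) k *
        conj (fourierMatrix N ((finEquivZMod N).symm j) k) *
        ((R ((finEquivZMod N).symm i) k : ℂ) - (R ((finEquivZMod N).symm j) k : ℂ)) =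
      (N : ℂ)⁻¹ * realDFT N (rowsZMod N R i - rowsZMod N R j) (j - i) := by
  rw [realDFT_apply, Finset.mul_sum, ← (finEquivZMod N).symm.sum_comp]
  refine Finset.sum_congr rfl fun k _ => ?_
  have hN : ((Real.sqrt N : ℝ) : ℂ) * ((Real.sqrt N : ℝ) : ℂ) = N := by
    rw [← Complex.ofReal_mul, Real.mul_self_sqrt (Nat.cast_nonneg N), Complex.ofReal_natCast]
  have hχ : (ZMod.stdAddChar (-(k * (j - i))) : ℂ) =
      ZMod.stdAddChar (i * k) * ZMod.stdAddChar (-(j * k)) := by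
    rw [← AddChar.map_add_eq_mul]
    congr 1
    ring
  simp only [fourierMatrix_apply_eq_stdAddChar, Equiv.apply_symm_apply, map_div₀,
    Complex.conj_ofReal, ← AddChar.map_neg_eq_conj]
  rw [hχ, ← hN]
  simp only [rowsZMod_apply, Pi.sub_apply]
  push_cast
  rw [mul_inv]
  ring

theorem mem_defectSpace_fourierMatrix_iff {N : ℕ} [NeZero N] (R : Matrix (Fin N) (Fin N) ℝ) :
    R ∈ defectSpace (fourierMatrix N) ↔
      ∀ i j, realDFT N (rowsZMod N R i - rowsZMod N R j) (j - i) = 0 := by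
  have hN : (N : ℂ)⁻¹ ≠ 0 := inv_ne_zero (Nat.cast_ne_zero.mpr (NeZero.ne N))
  have key (i j : Fin N) := sum_fourierMatrix_eq R (finEquivZMod N i) (finEquivZMod N j)
  simp only [Equiv.symm_apply_apply] at key
  have hmem : R ∈ defectSpace (fourierMatrix N) ↔ ∀ i j : Fin N, i < j →
      realDFT N (rowsZMod N R (finEquivZMod N i) - rowsZMod N R (finEquivZMod N j))
        (finEquivZMod N j - finEquivZMod N i) = 0 := by
    change (∀ i j : Fin N, i < j → _ = _) ↔ _
    simp only [key, mul_eq_zero, hN, false_or]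
  rw [hmem]
  refine ⟨fun h => ?_, fun h i j _ => h _ _⟩
  intro i j
  obtain ⟨i, rfl⟩ := (finEquivZMod N).surjective i
  obtain ⟨j, rfl⟩ := (finEquivZMod N).surjective j
  rcases lt_trichotomy i j with hij | rfl | hij
  · exact h i j hij
  · simp
  · have h' := h j i hij
    rw [← neg_sub (finEquivZMod N i), realDFT_neg, ← neg_sub (rowsZMod N R (finEquivZMod N j)),
      map_neg, Pi.neg_apply, h', neg_zero, map_zero]

theorem mem_defectSpace_fourierMatrix_iff_hartley {N : ℕ} [NeZero N]
    (R : Matrix (Fin N) (Fin N) ℝ) :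
    R ∈ defectSpace (fourierMatrix N) ↔
      ∀ m i, hartley N (rowsZMod N R (i + m)) m = hartley N (rowsZMod N R i) m := by
  rw [mem_defectSpace_fourierMatrix_iff]
  constructor
  · intro h m i
    have h' := ((realDFT_eq_zero_iff _ _).mp (h i (i + m))).1
    rw [add_sub_cancel_left, map_sub, Pi.sub_apply, sub_eq_zero] at h'
    exact h'.symm
  · intro h i j
    rw [realDFT_eq_zero_iff, neg_sub, map_sub, Pi.sub_apply, Pi.sub_apply, sub_eq_zero, sub_eq_zero]
    have h₁ := h (j - i) i
    have h₂ := h (i - j) j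
    rw [add_sub_cancel] at h₁ h₂
    exact ⟨h₁.symm, h₂⟩

/-- The Hartley transform of the rows of a real matrix, as a linear equivalence; the frequency is
the first variable. -/
def hartleyEquiv (N : ℕ) [NeZero N] :
    Matrix (Fin N) (Fin N) ℝ ≃ₗ[ℝ] (ZMod N → ZMod N → ℝ) :=
  LinearEquiv.ofInjectiveOfFinrankEq
    ({ toFun R m i := hartley N (rowsZMod N R i) m
       map_add' _ _ := by ext; simp
       map_smul' _ _ := by ext; simp } : Matrix (Fin N) (Fin N) ℝ →ₗ[ℝ] (ZMod N → ZMod N → ℝ))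
    (by
      intro R R' h
      ext i k
      have h' : rowsZMod N R (finEquivZMod N i) = rowsZMod N R' (finEquivZMod N i) :=
        hartley_injective N (funext fun m => congrFun (congrFun h m) (finEquivZMod N i))
      simpa [rowsZMod_apply] using congrFun h' (finEquivZMod N k))
    (by simp [Module.finrank_matrix, Module.finrank_pi_fintype])

/-- Functions on the quotients `ZMod N ⧸ ⟨m⟩`, pulled back to `ZMod N`. -/
def pullbackQuotient (N : ℕ) :
    ((m : ZMod N) → (ZMod N ⧸ AddSubgroup.zmultiples m) → ℝ) →ₗ[ℝ] (ZMod N → ZMod N → ℝ) where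
  toFun φ m i := φ m i
  map_add' _ _ := rfl
  map_smul' _ _ := rfl

theorem pullbackQuotient_injective (N : ℕ) : Function.Injective (pullbackQuotient N) := by
  intro φ ψ h
  funext m x
  induction x using QuotientAddGroup.induction_on with
  | H i => exact congrFun (congrFun h m) i

theorem mem_range_pullbackQuotient_iff {N : ℕ} (h : ZMod N → ZMod N → ℝ) :
    h ∈ LinearMap.range (pullbackQuotient N) ↔ ∀ m i, h m (i + m) = h m i := by
  constructor
  · rintro ⟨φ, rfl⟩ m i
    exact congrArg (φ m) (QuotientAddGroup.mk_add_of_mem i (AddSubgroup.mem_zmultiples m))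
  · intro hh
    have hz (m : ZMod N) (n : ℤ) (i : ZMod N) : h m (i + n • m) = h m i := by
      induction n with
      | zero => simp
      | succ n ih => rw [add_smul, one_smul, ← add_assoc, hh, ih]
      | pred n ih => rw [← ih, ← hh m, sub_smul, one_smul, add_assoc, sub_add_cancel]
    refine ⟨fun m => Quotient.lift (h m) ?_, rfl⟩
    intro a b hab
    obtain ⟨n, hn⟩ := QuotientAddGroup.leftRel_apply.mp hab
    have hb : b = a + n • m := by
      rw [show n • m = -a + b from hn, add_neg_cancel_left]
    rw [hb, hz]

theorem finrank_defectSpace_fourierMatrix (N : ℕ) [NeZero N] :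
    Module.finrank ℝ (defectSpace (fourierMatrix N)) =
      ∑ d ∈ N.divisors, d.totient * (N / d) := by
  have hS : defectSpace (fourierMatrix N) =
      (LinearMap.range (pullbackQuotient N)).comap (hartleyEquiv N).toLinearMap := by
    ext R
    rw [mem_defectSpace_fourierMatrix_iff_hartley, Submodule.mem_comap,
      mem_range_pullbackQuotient_iff]
    rfl
  have hcard (m : ZMod N) :
      Nat.card (ZMod N ⧸ AddSubgroup.zmultiples m) = N / addOrderOf m := by
    have h := AddSubgroup.card_eq_card_quotient_mul_card_addSubgroup (AddSubgroup.zmultiples m)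
    rw [Nat.card_zmod, Nat.card_zmultiples] at h
    exact Nat.eq_div_of_mul_eq_left (addOrderOf_pos m).ne' h.symm
  have hdvd (m : ZMod N) : addOrderOf m ∈ N.divisors := by
    refine Nat.mem_divisors.mpr ⟨?_, NeZero.ne N⟩
    simpa using addOrderOf_dvd_natCard m
  have (m : ZMod N) : Fintype (ZMod N ⧸ AddSubgroup.zmultiples m) := Fintype.ofFinite _
  rw [hS, ((hartleyEquiv N).ofSubmodule' _).finrank_eq,
    LinearMap.finrank_range_of_inj (pullbackQuotient_injective N), Module.finrank_pi_fintype]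
  simp only [Module.finrank_fintype_fun_eq_card, ← Nat.card_eq_fintype_card, hcard]
  rw [← Finset.sum_fiberwise_of_maps_to (fun m _ => hdvd m)]
  refine Finset.sum_congr rfl fun d hd => ?_
  rw [Finset.sum_congr rfl fun m hm => by rw [(Finset.mem_filter.mp hm).2], Finset.sum_const,
    smul_eq_mul, IsAddCyclic.card_addOrderOf_eq_totient (by simpa using Nat.dvd_of_mem_divisors hd)]

theorem sum_divisors_totient_mul_div {p q : ℕ} (hp : p.Prime) (hq : q.Prime) (hpq : p ≠ q) :
    ∑ d ∈ (p * q).divisors, d.totient * (p * q / d) = (2 * p - 1) * (2 * q - 1) := by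
  have hc : p.Coprime q := (Nat.coprime_primes hp hq).mpr hpq
  have hdiv : (p * q).divisors = (p.divisors ×ˢ q.divisors).image fun x => x.1 * x.2 := by
    rw [Nat.divisors_mul]
    rfl
  have h₁ : p * q / p = q := Nat.mul_div_cancel_left q hp.pos
  have h₂ : p * q / q = p := Nat.mul_div_cancel p hq.pos
  have h₃ : p * q / (p * q) = 1 := Nat.div_self (mul_pos hp.pos hq.pos)
  rw [hdiv, Finset.sum_image hc.mul_injOn_divisors, Finset.sum_product, hp.divisors, hq.divisors]
  simp only [Finset.sum_pair hp.ne_one.symm, Finset.sum_pair hq.ne_one.symm, one_mul, mul_one,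
    h₁, h₂, h₃, Nat.div_one, Nat.totient_one, Nat.totient_mul hc, Nat.totient_prime hp,
    Nat.totient_prime hq]
  obtain ⟨a, rfl⟩ := Nat.exists_eq_add_of_le' hp.one_le
  obtain ⟨b, rfl⟩ := Nat.exists_eq_add_of_le' hq.one_le
  rw [show 2 * (a + 1) - 1 = 2 * a + 1 by lia, show 2 * (b + 1) - 1 = 2 * b + 1 by lia,
    Nat.add_sub_cancel, Nat.add_sub_cancel]
  ring

/-- For distinct primes `p, q`: `d(F_{pq}) = 2(p-1)(q-1)`. -/
theorem defect_fourier_two_primes (p q : ℕ) (hp : p.Prime) (hq : q.Prime) (hpq : p ≠ q) :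
    defect (fourierMatrix (p * q)) = 2 * (p - 1) * (q - 1) := by
  have : NeZero (p * q) := ⟨mul_ne_zero hp.ne_zero hq.ne_zero⟩
  rw [defect, finrank_defectSpace_fourierMatrix, sum_divisors_totient_mul_div hp hq hpq]
  obtain ⟨a, rfl⟩ := Nat.exists_eq_add_of_le' hp.one_le
  obtain ⟨b, rfl⟩ := Nat.exists_eq_add_of_le' hq.one_le
  rw [show 2 * (a + 1) - 1 = 2 * a + 1 by lia, show 2 * (b + 1) - 1 = 2 * b + 1 by lia,
    show 2 * ((a + 1) * (b + 1)) - 1 = 2 * a * b + 2 * a + 2 * b + 1 by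
      rw [Nat.sub_eq_iff_eq_add (by nlinarith)]; ring,
    Nat.add_sub_cancel, Nat.add_sub_cancel]
  exact Nat.sub_eq_of_eq_add (by ring)

end
end

section
/- Let p, q, r be pairwise distinct prime numbers and N = p·q·r. Then the defect of the Fourier matrix satisfies d(F_{pqr}) = 2·(3pqr − 2(pq + pr + qr) + (p + q + r)). -/
open Matrix ComplexConjugate

noncomputable section

section ZeroProducts

/-- The number of pairs of elements of `R` with product zero. -/
def zeroProducts (R : Type*) [Mul R] [Zero R] : ℕ :=
  Nat.card {x : R × R // x.1 * x.2 = 0}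

theorem zeroProducts_congr {R S : Type*} [CommRing R] [CommRing S] (e : R ≃+* S) :
    zeroProducts R = zeroProducts S :=
  Nat.card_congr <| (e.toEquiv.prodCongr e.toEquiv).subtypeEquiv fun x => by
    simp [← map_mul]

theorem zeroProducts_prod (R S : Type*) [CommRing R] [CommRing S] :
    zeroProducts (R × S) = zeroProducts R * zeroProducts S := by
  rw [zeroProducts, zeroProducts, zeroProducts, ← Nat.card_prod]
  refine Nat.card_congr (Equiv.trans ?_ (Equiv.subtypeProdEquivProd (p := fun x : R × R =>
    x.1 * x.2 = 0) (q := fun x : S × S => x.1 * x.2 = 0)))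
  exact (Equiv.prodProdProdComm R S R S).subtypeEquiv fun x => by simp [Prod.ext_iff]

theorem zeroProducts_zmod_prime {p : ℕ} (hp : p.Prime) :
    (zeroProducts (ZMod p) : ℤ) = 2 * p - 1 := by
  have : Fact p.Prime := ⟨hp⟩
  have key : (Finset.univ.filter fun x : ZMod p × ZMod p => x.1 * x.2 = 0)
      = ({0} ×ˢ Finset.univ) ∪ (Finset.univ ×ˢ {0}) := by
    ext x
    simp only [Finset.mem_filter_univ, Finset.mem_union, Finset.mem_product,
      Finset.mem_singleton, Finset.mem_univ, and_true, true_and, mul_eq_zero]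
  have hcap : (({0} ×ˢ Finset.univ) ∩ (Finset.univ ×ˢ {0}) : Finset (ZMod p × ZMod p))
      = {(0, 0)} := by
    ext x
    simp only [Finset.mem_inter, Finset.mem_product, Finset.mem_singleton, Finset.mem_univ,
      and_true, true_and, Prod.ext_iff]
  have h := Finset.card_union_add_card_inter
    (({0} : Finset (ZMod p)) ×ˢ (Finset.univ : Finset (ZMod p))) (Finset.univ ×ˢ {0})
  rw [hcap, ← key] at h
  simp only [Finset.card_singleton, Finset.card_product, Finset.card_univ, ZMod.card] at h
  rw [zeroProducts, Nat.card_eq_fintype_card, Fintype.card_subtype]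
  omega

theorem zeroProducts_zmod_mul {m n : ℕ} (h : m.Coprime n) :
    zeroProducts (ZMod (m * n)) = zeroProducts (ZMod m) * zeroProducts (ZMod n) := by
  rw [zeroProducts_congr (ZMod.chineseRemainder h), zeroProducts_prod]

end ZeroProducts

section ShiftInvariance

open ZMod

variable {N : ℕ} [NeZero N]

/-- The discrete Fourier transform of a real matrix along each of its rows. -/
def rowDFT : Matrix (ZMod N) (ZMod N) ℝ →ₗ[ℝ] (ZMod N → ZMod N → ℂ) where
  toFun R i := 𝓕 fun k => (R i k : ℂ)
  map_add' R R' := by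
    ext i m
    simp [dft_apply, mul_add, Finset.sum_add_distrib]
  map_smul' c R := by
    ext i m
    simp [dft_apply, Finset.mul_sum, mul_left_comm]

theorem rowDFT_apply (R : Matrix (ZMod N) (ZMod N) ℝ) (i m : ZMod N) :
    rowDFT R i m = ∑ k, stdAddChar (-(k * m)) * (R i k : ℂ) := by
  simp [rowDFT, dft_apply]

theorem conj_rowDFT (R : Matrix (ZMod N) (ZMod N) ℝ) (i m : ZMod N) :
    conj (rowDFT R i m) = rowDFT R i (-m) := by
  simp [rowDFT_apply, ← AddChar.map_neg_eq_conj]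

/-- Real matrices whose `m`-th Fourier column is invariant under translation by `m`. -/
def shiftInvariant (N : ℕ) [NeZero N] : Submodule ℝ (Matrix (ZMod N) (ZMod N) ℝ) where
  carrier := {R | ∀ i m, rowDFT R (i + m) m = rowDFT R i m}
  zero_mem' := by simp
  add_mem' hR hR' i m := by simp [hR i m, hR' i m]
  smul_mem' c R hR i m := by simp [hR i m]

theorem rowDFT_add_mul_of_mem {R : Matrix (ZMod N) (ZMod N) ℝ} (hR : R ∈ shiftInvariant N)
    (i m t : ZMod N) : rowDFT R (i + t * m) m = rowDFT R i m := by
  rw [← ZMod.natCast_zmod_val t]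
  induction t.val with
  | zero => simp
  | succ n ih => rw [Nat.cast_succ, add_one_mul, ← add_assoc, hR, ih]

/-- The Fourier columns of `R`, the `m`-th one averaged over translations by multiples of `m`. -/
def averagedDFT (R : Matrix (ZMod N) (ZMod N) ℝ) (i m : ZMod N) : ℂ :=
  (N : ℂ)⁻¹ * ∑ t, rowDFT R (i + t * m) m

theorem conj_averagedDFT (R : Matrix (ZMod N) (ZMod N) ℝ) (i m : ZMod N) :
    conj (averagedDFT R i m) = averagedDFT R i (-m) := by
  simp only [averagedDFT, map_mul, map_inv₀, Complex.conj_natCast, map_sum, conj_rowDFT]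
  rw [← Equiv.sum_comp (Equiv.neg (ZMod N))]
  simp

theorem averagedDFT_add (R : Matrix (ZMod N) (ZMod N) ℝ) (i m : ZMod N) :
    averagedDFT R (i + m) m = averagedDFT R i m := by
  rw [averagedDFT, averagedDFT, ← Equiv.sum_comp (Equiv.addRight (1 : ZMod N))
    fun t => rowDFT R (i + t * m) m]
  simp [add_one_mul, add_assoc, add_comm m]

theorem ofReal_re_invDFT {f : ZMod N → ℂ} (hf : ∀ m, conj (f m) = f (-m)) (k : ZMod N) :
    ((𝓕⁻ f k).re : ℂ) = 𝓕⁻ f k := by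
  rw [← Complex.conj_eq_iff_re, invDFT_apply]
  simp only [smul_eq_mul, map_mul, map_inv₀, Complex.conj_natCast, map_sum, hf,
    ← AddChar.map_neg_eq_conj]
  rw [← Equiv.sum_comp (Equiv.neg (ZMod N))]
  simp

/-- The projection onto `shiftInvariant N` that averages the Fourier columns. -/
def shiftAverage (N : ℕ) [NeZero N] :
    Matrix (ZMod N) (ZMod N) ℝ →ₗ[ℝ] Matrix (ZMod N) (ZMod N) ℝ where
  toFun R := Matrix.of fun i k => (𝓕⁻ (averagedDFT R i) k).re
  map_add' R R' := by
    ext i k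
    have h : averagedDFT (R + R') i = averagedDFT R i + averagedDFT R' i := by
      ext m
      simp [averagedDFT, Finset.sum_add_distrib, mul_add]
    simp [h]
  map_smul' c R := by
    ext i k
    have h : averagedDFT (c • R) i = (c : ℂ) • averagedDFT R i := by
      ext m
      simp [averagedDFT, ← Finset.mul_sum, mul_left_comm]
    change (𝓕⁻ (averagedDFT (c • R) i) k).re = c * (𝓕⁻ (averagedDFT R i) k).re
    rw [h, _root_.map_smul, Pi.smul_apply, smul_eq_mul, Complex.re_ofReal_mul]

theorem ofReal_shiftAverage (R : Matrix (ZMod N) (ZMod N) ℝ) (i k : ZMod N) :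
    (shiftAverage N R i k : ℂ) = 𝓕⁻ (averagedDFT R i) k :=
  ofReal_re_invDFT (conj_averagedDFT R i) k

theorem rowDFT_shiftAverage (R : Matrix (ZMod N) (ZMod N) ℝ) (i : ZMod N) :
    rowDFT (shiftAverage N R) i = averagedDFT R i := by
  change 𝓕 (fun k => (shiftAverage N R i k : ℂ)) = _
  simp_rw [ofReal_shiftAverage]
  exact LinearEquiv.apply_symm_apply _ _

theorem isProj_shiftAverage : LinearMap.IsProj (shiftInvariant N) (shiftAverage N) where
  map_mem R i m := by simp [rowDFT_shiftAverage, averagedDFT_add]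
  map_id R hR := by
    ext i k
    have h : averagedDFT R i = rowDFT R i := by
      ext m
      simp [averagedDFT, rowDFT_add_mul_of_mem hR, ZMod.card, NeZero.ne]
    rw [← Complex.ofReal_inj, ofReal_shiftAverage, h]
    exact congrFun (LinearEquiv.symm_apply_apply dft fun k => (R i k : ℂ)) k

theorem rowDFT_single (i k j m : ZMod N) :
    rowDFT (Matrix.single i k 1) j m = if i = j then stdAddChar (-(k * m)) else 0 := by
  rw [rowDFT_apply]
  split_ifs with h <;> simp [Matrix.single_apply, h, apply_ite Complex.ofReal]

theorem shiftAverage_single (i k : ZMod N) :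
    (shiftAverage N (Matrix.single i k 1) i k : ℂ) =
      (N : ℂ)⁻¹ * (N : ℂ)⁻¹ * zeroProducts (ZMod N) := by
  rw [ofReal_shiftAverage, invDFT_apply, zeroProducts, Nat.card_eq_fintype_card,
    Fintype.card_subtype, Finset.card_filter, Fintype.sum_prod_type_right]
  simp only [averagedDFT, rowDFT_single, smul_eq_mul, left_eq_add, Nat.cast_sum, mul_assoc,
    Finset.mul_sum]
  refine Finset.sum_congr rfl fun m _ => Finset.sum_congr rfl fun t _ => ?_
  split_ifs with h
  · rw [mul_left_comm (stdAddChar _), ← AddChar.map_add_eq_mul, mul_comm m k]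
    simp
  · simp

theorem finrank_shiftInvariant : Module.finrank ℝ (shiftInvariant N) = zeroProducts (ZMod N) := by
  have h := (isProj_shiftAverage (N := N)).trace
  rw [LinearMap.trace_eq_matrix_trace ℝ (Matrix.stdBasis ℝ (ZMod N) (ZMod N)), Matrix.trace,
    ← Complex.ofReal_inj] at h
  have hdiag (x : ZMod N × ZMod N) :
      (((LinearMap.toMatrix (Matrix.stdBasis ℝ (ZMod N) (ZMod N))
        (Matrix.stdBasis ℝ (ZMod N) (ZMod N)) (shiftAverage N)).diag x : ℝ) : ℂ) =
      (N : ℂ)⁻¹ * (N : ℂ)⁻¹ * zeroProducts (ZMod N) := by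
    obtain ⟨i, k⟩ := x
    rw [Matrix.diag_apply, LinearMap.toMatrix_apply, Matrix.stdBasis_eq_single,
      ← shiftAverage_single i k]
    rfl
  have hN : (N : ℂ) ≠ 0 := NeZero.ne _
  rw [Complex.ofReal_sum, Finset.sum_congr rfl fun x _ => hdiag x] at h
  simp only [Finset.sum_const, Finset.card_univ, Fintype.card_prod, ZMod.card, nsmul_eq_mul,
    Nat.cast_mul, Complex.ofReal_natCast] at h
  field_simp at h
  exact_mod_cast h.symm

end ShiftInvariance

section FourierMatrix

open ZMod

variable {N : ℕ} [NeZero N]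

theorem finEquiv_apply (i : Fin N) : finEquiv N i = ((i : ℕ) : ZMod N) := by
  cases N with
  | zero => exact i.elim0
  | succ n => exact (ZMod.natCast_zmod_val (n := n + 1) i).symm

theorem fourierMatrix_apply (i j : Fin N) :
    fourierMatrix N i j =
      stdAddChar (finEquiv N i * finEquiv N j) / (Real.sqrt N : ℝ) := by
  have h : finEquiv N i * finEquiv N j = (((i : ℕ) * (j : ℕ) : ℤ) : ZMod N) := by
    simp [finEquiv_apply]
  rw [h, stdAddChar_coe, fourierMatrix, Matrix.of_apply]
  push_cast
  rw [← mul_assoc]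

/-- Reindexing of matrices along `Fin N ≃ ZMod N`. -/
def reindexZMod (N : ℕ) [NeZero N] :
    Matrix (Fin N) (Fin N) ℝ ≃ₗ[ℝ] Matrix (ZMod N) (ZMod N) ℝ :=
  Matrix.reindexLinearEquiv ℝ ℝ (finEquiv N).toEquiv (finEquiv N).toEquiv

theorem sum_fourierMatrix (R : Matrix (Fin N) (Fin N) ℝ) (i j : Fin N) :
    ∑ k, fourierMatrix N i k * conj (fourierMatrix N j k) * ((R i k : ℂ) - (R j k : ℂ)) =
      (N : ℂ)⁻¹ * (rowDFT (reindexZMod N R) (finEquiv N i) (finEquiv N j - finEquiv N i) -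
        rowDFT (reindexZMod N R) (finEquiv N j) (finEquiv N j - finEquiv N i)) := by
  rw [rowDFT_apply, rowDFT_apply, ← Finset.sum_sub_distrib, Finset.mul_sum,
    ← Equiv.sum_comp (finEquiv N).toEquiv]
  refine Finset.sum_congr rfl fun k _ => ?_
  have hs : ((Real.sqrt N : ℝ) : ℂ) * (Real.sqrt N : ℝ) = N := by
    rw [← Complex.ofReal_mul, Real.mul_self_sqrt N.cast_nonneg, Complex.ofReal_natCast]
  have hc : (stdAddChar (-(finEquiv N k * (finEquiv N j - finEquiv N i))) : ℂ) =
      stdAddChar (finEquiv N i * finEquiv N k) * stdAddChar (-(finEquiv N j * finEquiv N k)) := by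
    rw [← AddChar.map_add_eq_mul]
    ring_nf
  simp only [fourierMatrix_apply, map_div₀, Complex.conj_ofReal, ← AddChar.map_neg_eq_conj,
    reindexZMod, Matrix.coe_reindexLinearEquiv, Matrix.reindex_apply, Matrix.submatrix_apply,
    RingEquiv.toEquiv_eq_coe, RingEquiv.coe_toEquiv, hc]
  rw [← hs, mul_inv]
  simp [← RingEquiv.coe_toEquiv_symm]
  ring

theorem defectSpace_fourierMatrix :
    defectSpace (fourierMatrix N) =
      (shiftInvariant N).comap (reindexZMod N : _ →ₗ[ℝ] Matrix (ZMod N) (ZMod N) ℝ) := by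
  have hN : (N : ℂ)⁻¹ ≠ 0 := inv_ne_zero (NeZero.ne _)
  ext R
  change (∀ i j : Fin N, i < j → _) ↔ ∀ i m, _
  simp only [sum_fourierMatrix, mul_eq_zero, hN, false_or, sub_eq_zero]
  constructor
  · intro h
    have key (i j : Fin N) :
        rowDFT (reindexZMod N R) (finEquiv N i) (finEquiv N j - finEquiv N i) =
          rowDFT (reindexZMod N R) (finEquiv N j) (finEquiv N j - finEquiv N i) := by
      rcases lt_trichotomy i j with hij | rfl | hij
      · exact h i j hij
      · rfl
      · rw [← neg_sub (finEquiv N i), ← conj_rowDFT, ← conj_rowDFT, h j i hij]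
    intro i m
    simpa using (key ((finEquiv N).symm i) ((finEquiv N).symm (i + m))).symm
  · intro h i j _
    simpa using (h (finEquiv N i) (finEquiv N j - finEquiv N i)).symm

theorem finrank_defectSpace_fourierMatrix_s16 :
    Module.finrank ℝ (defectSpace (fourierMatrix N)) = zeroProducts (ZMod N) := by
  rw [defectSpace_fourierMatrix, ← finrank_shiftInvariant]
  exact ((reindexZMod N).ofSubmodule' (shiftInvariant N)).finrank_eq

end FourierMatrix

/-- For pairwise distinct primes `p, q, r`:
`d(F_{pqr}) = 2(3pqr - 2(pq + pr + qr) + (p + q + r))`. -/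
theorem defect_fourier_three_primes (p q r : ℕ) (hp : p.Prime) (hq : q.Prime) (hr : r.Prime)
    (hpq : p ≠ q) (hpr : p ≠ r) (hqr : q ≠ r) :
    (defect (fourierMatrix (p * q * r)) : ℤ) =
      2 * (3 * (p * q * r : ℤ) - 2 * ((p * q : ℤ) + p * r + q * r) + ((p : ℤ) + q + r)) := by
  have : NeZero (p * q * r) := ⟨mul_ne_zero (mul_ne_zero hp.ne_zero hq.ne_zero) hr.ne_zero⟩
  have hcop : (p * q).Coprime r :=
    ((Nat.coprime_primes hp hr).2 hpr).mul_left ((Nat.coprime_primes hq hr).2 hqr)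
  have hcard : (zeroProducts (ZMod (p * q * r)) : ℤ) =
      (2 * p - 1) * (2 * q - 1) * (2 * r - 1) := by
    rw [zeroProducts_zmod_mul hcop, zeroProducts_zmod_mul ((Nat.coprime_primes hp hq).2 hpq)]
    push_cast
    rw [zeroProducts_zmod_prime hp, zeroProducts_zmod_prime hq, zeroProducts_zmod_prime hr]
  have hpos : 1 ≤ 2 * (p * q * r) := by have := NeZero.pos (p * q * r); omega
  have hp2 : (2 : ℤ) ≤ p := by exact_mod_cast hp.two_le
  have hq2 : (2 : ℤ) ≤ q := by exact_mod_cast hq.two_le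
  have hr2 : (2 : ℤ) ≤ r := by exact_mod_cast hr.two_le
  have hle : 2 * (p * q * r) - 1 ≤ zeroProducts (ZMod (p * q * r)) := by
    zify [hpos]
    rw [hcard]
    have h1 : (p * q : ℤ) ≤ (2 * p - 1) * (2 * q - 1) := by nlinarith
    have h2 : (0 : ℤ) ≤ (p : ℤ) * q := by positivity
    have h3 : (2 * p - 1) * (2 * q - 1) * (2 * r - 1) ≥ (p * q : ℤ) * (2 * r - 1) :=
      mul_le_mul_of_nonneg_right h1 (by linarith)
    have h4 : (2 * p - 1) * (2 * q - 1) ≥ (2 * (p * q) : ℤ) := by nlinarith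
    nlinarith
  rw [defect, finrank_defectSpace_fourierMatrix_s16, Nat.cast_sub hle, hcard, Nat.cast_sub hpos]
  push_cast
  ring

end
end
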